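/- arXiv:1604.02181 — 10 statements merged into one kernel-verified Lean document; each statement's English description precedes it below -/
import Mathlib

section
/- Let d, n be positive integers, let W be a d×n real matrix with nonnegative entries, let x ∈ ℝ^d have nonnegative entries, let λ ≥ 0, let q ∈ ℝ^n have nonnegative entries, and let z ∈ {1,2}. Define Q(h) = ‖x − Wh‖₂² + λ·Σ_{i=1}^n q_i·h_i^z. Let h ∈ ℝ^n have strictly positive entries and define the multiplicative update h⁺ by h⁺_i = h_i·(Wᵀx)_i / ((WᵀWh)_i + (λ·z·q_i/2)·h_i^{z−1}), assuming each denominator (WᵀWh)_i + (λ·z·q_i/2)·h_i^{z−1} is strictly positive. Then every entry of h⁺ is nonnegative and Q(h⁺) ≤ Q(h). -/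
open Matrix BigOperators

/-- Diagonal majorization of the Gram form of a nonnegative matrix, weighted by a positive vector. -/
theorem sum_sq_mulVec_le_of_nonneg {m n : Type*} [Fintype m] [Fintype n]
    {W : Matrix m n ℝ} (hW : ∀ i j, 0 ≤ W i j) {h : n → ℝ} (hpos : ∀ i, 0 < h i) (v : n → ℝ) :
    ∑ k, (W *ᵥ v) k ^ 2 ≤ ∑ i, ((Wᵀ * W) *ᵥ h) i * (v i ^ 2 / h i) := by
  have row (k : m) : (W *ᵥ v) k ^ 2 ≤ (W *ᵥ h) k * ∑ i, W k i * (v i ^ 2 / h i) := by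
    refine Finset.sum_sq_le_sum_mul_sum_of_sq_le_mul _ (fun i _ => ?_) (fun i _ => ?_)
      (fun i _ => ?_)
    · exact mul_nonneg (hW k i) (hpos i).le
    · exact mul_nonneg (hW k i) (div_nonneg (sq_nonneg _) (hpos i).le)
    · have := (hpos i).ne'
      refine le_of_eq ?_
      field_simp
  calc ∑ k, (W *ᵥ v) k ^ 2 ≤ ∑ k, (W *ᵥ h) k * ∑ i, W k i * (v i ^ 2 / h i) :=
        Finset.sum_le_sum fun k _ => row k
    _ = (W *ᵥ h) ⬝ᵥ (W *ᵥ fun i => v i ^ 2 / h i) := rfl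
    _ = ((Wᵀ * W) *ᵥ h) ⬝ᵥ fun i => v i ^ 2 / h i := by
        rw [dotProduct_mulVec, ← mulVec_transpose, mulVec_mulVec]

/-- Expansion of the least squares residual around `h`. -/
theorem sum_sq_sub_mulVec_add {m n : Type*} [Fintype m] [Fintype n]
    (W : Matrix m n ℝ) (x : m → ℝ) (h v : n → ℝ) :
    ∑ k, (x k - (W *ᵥ (h + v)) k) ^ 2 = ∑ k, (x k - (W *ᵥ h) k) ^ 2 +
      ∑ k, (W *ᵥ v) k ^ 2 + ∑ i, 2 * (((Wᵀ * W) *ᵥ h) i - (Wᵀ *ᵥ x) i) * v i := by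
  have cross : ∑ i, (((Wᵀ * W) *ᵥ h) i - (Wᵀ *ᵥ x) i) * v i =
      ∑ k, ((W *ᵥ h) k - x k) * (W *ᵥ v) k := by
    change ((Wᵀ * W) *ᵥ h - Wᵀ *ᵥ x) ⬝ᵥ v = (W *ᵥ h - x) ⬝ᵥ (W *ᵥ v)
    rw [dotProduct_mulVec, ← mulVec_transpose, mulVec_sub, mulVec_mulVec]
  simp only [mul_assoc, ← Finset.mul_sum]
  rw [cross, Finset.mul_sum, ← Finset.sum_add_distrib, ← Finset.sum_add_distrib]
  refine Finset.sum_congr rfl fun k _ => ?_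
  rw [mulVec_add, Pi.add_apply]
  ring

/-- Monotonicity and non-negativity of the multiplicative update for the
weighted sparse non-negative least squares surrogate objective. -/
theorem stmt_0 (d n : ℕ) (hd : 0 < d) (hn : 0 < n)
    (W : Matrix (Fin d) (Fin n) ℝ) (hW : ∀ i j, 0 ≤ W i j)
    (x : Fin d → ℝ) (hx : ∀ i, 0 ≤ x i)
    (lam : ℝ) (hlam : 0 ≤ lam)
    (q : Fin n → ℝ) (hq : ∀ i, 0 ≤ q i)
    (z : ℕ) (hz : z = 1 ∨ z = 2)
    (Q : (Fin n → ℝ) → ℝ)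
    (hQ : ∀ h, Q h = ∑ i, (x i - W.mulVec h i) ^ 2 + lam * ∑ i, q i * h i ^ z)
    (h : Fin n → ℝ) (hpos : ∀ i, 0 < h i)
    (hden : ∀ i, 0 < (Wᵀ * W).mulVec h i + lam * z * q i / 2 * h i ^ (z - 1))
    (hplus : Fin n → ℝ)
    (hplusdef : ∀ i, hplus i =
      h i * Wᵀ.mulVec x i /
        ((Wᵀ * W).mulVec h i + lam * z * q i / 2 * h i ^ (z - 1))) :
    (∀ i, 0 ≤ hplus i) ∧ Q hplus ≤ Q h := by
  refine ⟨fun i => ?_, ?_⟩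
  · rw [hplusdef]
    have hb : 0 ≤ (Wᵀ *ᵥ x) i := dotProduct_nonneg_of_nonneg (fun k => hW k i) hx
    exact div_nonneg (mul_nonneg (hpos i).le hb) (hden i).le
  set c : Fin n → ℝ := fun i => lam * z * q i / 2 * h i ^ (z - 1) with hc
  set v : Fin n → ℝ := hplus - h with hv
  have hadd : hplus = h + v := by simp [hv]
  have penalty (i : Fin n) :
      lam * (q i * hplus i ^ z) ≤
        lam * (q i * h i ^ z) + 2 * c i * v i + c i * (v i ^ 2 / h i) := by
    have hi := hpos i
    have hlq := mul_nonneg hlam (hq i)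
    rw [hadd, Pi.add_apply]
    rcases hz with rfl | rfl
    · have : 0 ≤ lam * q i / 2 * (v i ^ 2 / h i) := by positivity
      simp only [hc, Nat.cast_one, Nat.sub_self, pow_zero]
      linarith
    · refine le_of_eq ?_
      simp only [hc, Nat.cast_ofNat, Nat.add_one_sub_one, pow_one]
      field_simp
      ring
  have step (i : Fin n) :
      ((Wᵀ * W) *ᵥ h) i * (v i ^ 2 / h i) +
        2 * (((Wᵀ * W) *ᵥ h) i - (Wᵀ *ᵥ x) i) * v i +
        (2 * c i * v i + c i * (v i ^ 2 / h i)) ≤ 0 := by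
    have hi := hpos i
    have hD : 0 < ((Wᵀ * W) *ᵥ h) i + c i := hden i
    have hb : (Wᵀ *ᵥ x) i = (((Wᵀ * W) *ᵥ h) i + c i) * (1 + v i / h i) := by
      have hp : hplus i = h i * (Wᵀ *ᵥ x) i / (((Wᵀ * W) *ᵥ h) i + c i) := hplusdef i
      rw [hadd, Pi.add_apply, eq_div_iff hD.ne'] at hp
      field_simp
      linarith
    have hnonneg : 0 ≤ (((Wᵀ * W) *ᵥ h) i + c i) * (v i ^ 2 / h i) := by positivity
    rw [hb]
    linear_combination hnonneg
  have hpen := Finset.sum_le_sum fun i (_ : i ∈ Finset.univ) => penalty i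
  have hstep := Finset.sum_nonpos fun i (_ : i ∈ Finset.univ) => step i
  have hgram := sum_sq_mulVec_le_of_nonneg hW hpos v
  have hres := sum_sq_sub_mulVec_add W x h v
  rw [← hadd] at hres
  rw [hQ, hQ, hres, Finset.mul_sum, Finset.mul_sum]
  simp only [Finset.sum_add_distrib] at hpen hstep
  linarith
end

section
/- Let A be an n×n real symmetric matrix all of whose entries are nonnegative, and let h ∈ ℝ^n have strictly positive entries. Then the matrix D − A is positive semidefinite, where D is the diagonal matrix with diagonal entries D_{ii} = (Ah)_i / h_i. -/
open Matrix BigOperators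

/-- The quadratic form of `diag ((A h)_i / h_i) - A` as a weighted sum of squares. -/
theorem dotProduct_diagonal_sub_mulVec_eq_sum_sq {ι : Type*} [Fintype ι] [DecidableEq ι]
    {A : Matrix ι ι ℝ} (hA : A.IsSymm) {h : ι → ℝ} (hh : ∀ i, h i ≠ 0) (v : ι → ℝ) :
    v ⬝ᵥ (Matrix.diagonal (fun i => A.mulVec h i / h i) - A).mulVec v =
      (∑ i, ∑ j, A i j * (h i * h j) * (v i / h i - v j / h j) ^ 2) / 2 := by
  have hswap : ∑ i, ∑ j, A i j * h j / h i * v i ^ 2 = ∑ i, ∑ j, A i j * h i / h j * v j ^ 2 := by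
    rw [Finset.sum_comm]
    simp_rw [hA.apply]
  have hquad : v ⬝ᵥ (Matrix.diagonal (fun i => A.mulVec h i / h i) - A).mulVec v =
      ∑ i, ∑ j, A i j * h j / h i * v i ^ 2 - ∑ i, ∑ j, A i j * v i * v j := by
    rw [Matrix.sub_mulVec, dotProduct_sub]
    congr 1
    · simp only [dotProduct, Matrix.mulVec_diagonal]
      simp only [Matrix.mulVec, dotProduct, Finset.sum_div, Finset.sum_mul, Finset.mul_sum]
      exact Finset.sum_congr rfl fun i _ => Finset.sum_congr rfl fun j _ => by ring
    · simp only [Matrix.mulVec, dotProduct, Finset.mul_sum]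
      exact Finset.sum_congr rfl fun i _ => Finset.sum_congr rfl fun j _ => by ring
  have hsq : ∑ i, ∑ j, A i j * (h i * h j) * (v i / h i - v j / h j) ^ 2 =
      ∑ i, ∑ j, A i j * h j / h i * v i ^ 2 + ∑ i, ∑ j, A i j * h i / h j * v j ^ 2 -
        2 * ∑ i, ∑ j, A i j * v i * v j := by
    simp only [Finset.mul_sum, ← Finset.sum_add_distrib, ← Finset.sum_sub_distrib]
    refine Finset.sum_congr rfl fun i _ => Finset.sum_congr rfl fun j _ => ?_
    have hi := hh i
    have hj := hh j
    field_simp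
    ring
  rw [hquad, hsq, ← hswap]
  ring

/-- For a symmetric entrywise-nonnegative matrix `A` and a vector `h` with strictly
positive entries, `D - A` is positive semidefinite where `D = diag ((A h)_i / h_i)`. -/
theorem stmt_1 (n : ℕ) (A : Matrix (Fin n) (Fin n) ℝ)
    (hsymm : A.IsSymm) (hnn : ∀ i j, 0 ≤ A i j)
    (h : Fin n → ℝ) (hpos : ∀ i, 0 < h i) :
    (Matrix.diagonal (fun i => A.mulVec h i / h i) - A).PosSemidef := by
  refine .of_dotProduct_mulVec_nonneg ?_ fun v => ?_
  · exact (Matrix.isHermitian_diagonal _).sub ((Matrix.conjTranspose_eq_transpose_of_trivial A).trans hsymm)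
  · rw [star_trivial, dotProduct_diagonal_sub_mulVec_eq_sum_sq hsymm fun i => (hpos i).ne']
    refine div_nonneg (Finset.sum_nonneg fun i _ => Finset.sum_nonneg fun j _ => ?_) two_pos.le
    exact mul_nonneg (mul_nonneg (hnn i j) (mul_pos (hpos i) (hpos j)).le) (sq_nonneg _)
end

section
/- Let W be a d×n real matrix with nonnegative entries, x ∈ ℝ^d, λ ≥ 0, q ∈ ℝ^n with nonnegative entries, and z ∈ {1,2}. Define Q(h) = ‖x − Wh‖₂² + λ·Σ_{i=1}^n q_i·h_i^z. Let h^s ∈ ℝ^n have strictly positive entries, let K be the diagonal matrix with K_{ii} = (2(WᵀWh^s)_i + λ·z·q_i·(h^s_i)^{z−1}) / h^s_i, and define G(h) = Q(h^s) + (h − h^s)ᵀ∇Q(h^s) + ½·(h − h^s)ᵀK(h − h^s), where ∇Q(h^s) = 2WᵀWh^s − 2Wᵀx + λ·z·(q_i·(h^s_i)^{z−1})_i. Then G(h^s) = Q(h^s) and G(h) ≥ Q(h) for every h ∈ ℝ^n; that is, G is an auxiliary (majorizing) function for Q at h^s. -/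
open Matrix BigOperators

/-- The diagonal matrix with entries `(Wᵀ W v)ᵢ / vᵢ` dominates `Wᵀ W` for nonnegative `W` and
positive `v`. -/
theorem sum_sq_mulVec_le {m n : Type*} [Fintype m] [Fintype n]
    (W : Matrix m n ℝ) (hW : ∀ i j, 0 ≤ W i j)
    (v : n → ℝ) (hv : ∀ i, 0 < v i) (u : n → ℝ) :
    ∑ a, (W *ᵥ u) a ^ 2 ≤ ∑ i, ((Wᵀ * W) *ᵥ v) i / v i * u i ^ 2 := by
  have hrow (a : m) : (W *ᵥ u) a ^ 2 ≤ (W *ᵥ v) a * ∑ j, W a j * (u j ^ 2 / v j) := by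
    simp only [mulVec, dotProduct]
    refine Finset.sum_sq_le_sum_mul_sum_of_sq_le_mul _ (fun j _ => mul_nonneg (hW a j) (hv j).le)
      (fun j _ => mul_nonneg (hW a j) (div_nonneg (sq_nonneg _) (hv j).le)) fun j _ => le_of_eq ?_
    have := (hv j).ne'
    field_simp
  refine (Finset.sum_le_sum fun a _ => hrow a).trans_eq ?_
  simp only [← mulVec_mulVec, Finset.mul_sum]
  rw [Finset.sum_comm]
  refine Finset.sum_congr rfl fun j _ => ?_
  rw [mulVec, dotProduct, Finset.sum_div, Finset.sum_mul]
  refine Finset.sum_congr rfl fun a _ => ?_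
  rw [transpose_apply]
  ring

/-- Second-order expansion of the least-squares loss. -/
theorem sum_sq_sub_mulVec_expand {m n : Type*} [Fintype m] [Fintype n]
    (W : Matrix m n ℝ) (x : m → ℝ) (v h : n → ℝ) :
    ∑ a, (x a - (W *ᵥ h) a) ^ 2 = ∑ a, (x a - (W *ᵥ v) a) ^ 2
      + ∑ i, (h i - v i) * (2 * ((Wᵀ * W) *ᵥ v) i - 2 * (Wᵀ *ᵥ x) i)
      + ∑ a, (W *ᵥ (h - v)) a ^ 2 := by
  have hgrad : ∑ i, (h i - v i) * (2 * ((Wᵀ * W) *ᵥ v) i - 2 * (Wᵀ *ᵥ x) i)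
      = ∑ a, 2 * (W *ᵥ (h - v)) a * ((W *ᵥ v) a - x a) := by
    have hadj : (h - v) ⬝ᵥ (Wᵀ *ᵥ (W *ᵥ v - x)) = (W *ᵥ (h - v)) ⬝ᵥ (W *ᵥ v - x) := by
      rw [dotProduct_mulVec, vecMul_transpose]
    rw [mulVec_sub, mulVec_mulVec] at hadj
    simp only [dotProduct, Pi.sub_apply] at hadj
    simp only [mul_assoc, ← Finset.mul_sum, ← hadj]
    rw [Finset.mul_sum]
    exact Finset.sum_congr rfl fun i _ => by ring
  rw [hgrad, ← Finset.sum_add_distrib, ← Finset.sum_add_distrib]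
  refine Finset.sum_congr rfl fun a _ => ?_
  rw [mulVec_sub, Pi.sub_apply]
  ring

/-- The penalty `t ↦ t ^ z` with `z ∈ {1, 2}` lies below its tangent at `s > 0` plus the quadratic
term of curvature `z * s ^ (z - 1) / s`. -/
theorem pow_le_quadratic_majorant {z : ℕ} (hz : z = 1 ∨ z = 2) {s : ℝ} (hs : 0 < s) (t : ℝ) :
    t ^ z ≤ s ^ z + (t - s) * (z * s ^ (z - 1))
      + 1 / 2 * (z * s ^ (z - 1) / s * (t - s) ^ 2) := by
  rcases hz with rfl | rfl
  · have : 0 ≤ 1 / s * (t - s) ^ 2 := by positivity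
    norm_num at this ⊢
    linarith
  · have := hs.ne'
    norm_num
    field_simp
    linarith

/-- The quadratic function `G` built from the diagonal curvature matrix `K` is an
auxiliary (majorizing) function for the S-NNLS surrogate objective `Q` at `h^s`. -/
theorem stmt_2 (d n : ℕ)
    (W : Matrix (Fin d) (Fin n) ℝ) (hW : ∀ i j, 0 ≤ W i j)
    (x : Fin d → ℝ)
    (lam : ℝ) (hlam : 0 ≤ lam)
    (q : Fin n → ℝ) (hq : ∀ i, 0 ≤ q i)
    (z : ℕ) (hz : z = 1 ∨ z = 2)
    (Q : (Fin n → ℝ) → ℝ)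
    (hQ : ∀ h, Q h = ∑ i, (x i - W.mulVec h i) ^ 2 + lam * ∑ i, q i * h i ^ z)
    (hs : Fin n → ℝ) (hpos : ∀ i, 0 < hs i)
    (G : (Fin n → ℝ) → ℝ)
    (hG : ∀ h, G h = Q hs
      + ∑ i, (h i - hs i) *
          (2 * (Wᵀ * W).mulVec hs i - 2 * Wᵀ.mulVec x i + lam * z * (q i * hs i ^ (z - 1)))
      + 1 / 2 * ∑ i,
          ((2 * (Wᵀ * W).mulVec hs i + lam * z * q i * hs i ^ (z - 1)) / hs i) *
            (h i - hs i) ^ 2) :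
    G hs = Q hs ∧ ∀ h : Fin n → ℝ, Q h ≤ G h := by
  refine ⟨by simp [hG], fun h => ?_⟩
  have hquad := sum_sq_mulVec_le W hW hs hpos (h - hs)
  have hpen : lam * ∑ i, q i * h i ^ z ≤ lam * ∑ i, q i * hs i ^ z
      + ∑ i, (h i - hs i) * (lam * z * (q i * hs i ^ (z - 1)))
      + 1 / 2 * ∑ i, (lam * z * q i * hs i ^ (z - 1)) / hs i * (h i - hs i) ^ 2 := by
    simp only [Finset.mul_sum, ← Finset.sum_add_distrib]
    refine Finset.sum_le_sum fun i _ => ?_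
    have := mul_le_mul_of_nonneg_left (pow_le_quadratic_majorant hz (hpos i) (h i))
      (mul_nonneg hlam (hq i))
    refine (le_of_eq (by ring)).trans (this.trans_eq (by ring))
  have hsplit : ∑ i, ((2 * (Wᵀ * W).mulVec hs i + lam * z * q i * hs i ^ (z - 1)) / hs i) *
        (h i - hs i) ^ 2
      = 2 * ∑ i, ((Wᵀ * W) *ᵥ hs) i / hs i * (h - hs) i ^ 2
        + ∑ i, (lam * z * q i * hs i ^ (z - 1)) / hs i * (h i - hs i) ^ 2 := by
    rw [Finset.mul_sum, ← Finset.sum_add_distrib]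
    refine Finset.sum_congr rfl fun i _ => ?_
    rw [Pi.sub_apply]
    ring
  rw [hG, hQ h, hQ hs, hsplit, sum_sq_sub_mulVec_expand W x hs h]
  simp only [mul_add, Finset.sum_add_distrib] at hpen ⊢
  linarith
end

section
/- Let W be a d×n real matrix with nonnegative entries, x ∈ ℝ^d with nonnegative entries, λ ≥ 0, q ∈ ℝ^n with nonnegative entries, and z ∈ {1,2}. Define Q(h) = ‖x − Wh‖₂² + λ·Σ_{i=1}^n q_i·h_i^z. Let h^s ∈ ℝ^n have strictly positive entries and suppose each quantity (WᵀWh^s)_i + (λ·z·q_i/2)·(h^s_i)^{z−1} is strictly positive. Let K be the diagonal matrix with K_{ii} = (2(WᵀWh^s)_i + λ·z·q_i·(h^s_i)^{z−1}) / h^s_i and define G(h) = Q(h^s) + (h − h^s)ᵀ∇Q(h^s) + ½·(h − h^s)ᵀK(h − h^s), where ∇Q(h^s) = 2WᵀWh^s − 2Wᵀx + λ·z·(q_i·(h^s_i)^{z−1})_i. Then G has a unique global minimizer over ℝ^n, given in closed form by the multiplicative update h⁺_i = h^s_i·(Wᵀx)_i / ((WᵀWh^s)_i + (λ·z·q_i/2)·(h^s_i)^{z−1}).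 -/
open Matrix BigOperators

theorem separable_quadratic_sub_eq {s D b p t : ℝ} (hs : s ≠ 0) (hD : D ≠ 0)
    (hp : p = s * b / D) :
    ((t - s) * (2 * D - 2 * b) + D / s * (t - s) ^ 2)
      - ((p - s) * (2 * D - 2 * b) + D / s * (p - s) ^ 2) = D / s * (t - p) ^ 2 := by
  subst hp
  field_simp
  ring

/-- The auxiliary quadratic `G` has a unique global minimizer over `ℝ^n`, given in
closed form by the multiplicative update. -/
theorem stmt_3 (d n : ℕ)
    (W : Matrix (Fin d) (Fin n) ℝ) (hW : ∀ i j, 0 ≤ W i j)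
    (x : Fin d → ℝ) (hx : ∀ i, 0 ≤ x i)
    (lam : ℝ) (hlam : 0 ≤ lam)
    (q : Fin n → ℝ) (hq : ∀ i, 0 ≤ q i)
    (z : ℕ) (hz : z = 1 ∨ z = 2)
    (Q : (Fin n → ℝ) → ℝ)
    (hQ : ∀ h, Q h = ∑ i, (x i - W.mulVec h i) ^ 2 + lam * ∑ i, q i * h i ^ z)
    (hs : Fin n → ℝ) (hpos : ∀ i, 0 < hs i)
    (hden : ∀ i, 0 < (Wᵀ * W).mulVec hs i + lam * z * q i / 2 * hs i ^ (z - 1))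
    (G : (Fin n → ℝ) → ℝ)
    (hG : ∀ h, G h = Q hs
      + ∑ i, (h i - hs i) *
          (2 * (Wᵀ * W).mulVec hs i - 2 * Wᵀ.mulVec x i + lam * z * (q i * hs i ^ (z - 1)))
      + 1 / 2 * ∑ i,
          ((2 * (Wᵀ * W).mulVec hs i + lam * z * q i * hs i ^ (z - 1)) / hs i) *
            (h i - hs i) ^ 2)
    (hplus : Fin n → ℝ)
    (hplusdef : ∀ i, hplus i =
      hs i * Wᵀ.mulVec x i /
        ((Wᵀ * W).mulVec hs i + lam * z * q i / 2 * hs i ^ (z - 1))) :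
    ∀ h : Fin n → ℝ, h ≠ hplus → G hplus < G h := by
  intro h hne
  set D : Fin n → ℝ :=
    fun i => (Wᵀ * W).mulVec hs i + lam * z * q i / 2 * hs i ^ (z - 1) with hD
  have hGD : ∀ h, G h = Q hs + ∑ i, ((h i - hs i) * (2 * D i - 2 * Wᵀ.mulVec x i)
      + D i / hs i * (h i - hs i) ^ 2) := by
    intro h
    rw [hG, add_assoc, Finset.mul_sum, ← Finset.sum_add_distrib]
    congr 1
    refine Finset.sum_congr rfl fun i _ => ?_
    simp only [hD]
    ring
  have hdiff : G h - G hplus = ∑ i, D i / hs i * (h i - hplus i) ^ 2 := by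
    rw [hGD, hGD, add_sub_add_left_eq_sub, ← Finset.sum_sub_distrib]
    exact Finset.sum_congr rfl fun i _ =>
      separable_quadratic_sub_eq (hpos i).ne' (hden i).ne' (hplusdef i)
  obtain ⟨j, hj⟩ := Function.ne_iff.mp hne
  have hsum : 0 < ∑ i, D i / hs i * (h i - hplus i) ^ 2 :=
    Finset.sum_pos'
      (fun i _ => mul_nonneg (div_pos (hden i) (hpos i)).le (sq_nonneg _))
      ⟨j, Finset.mem_univ j,
        mul_pos (div_pos (hden j) (hpos j)) (sq_pos_of_ne_zero (sub_ne_zero.mpr hj))⟩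
  linarith
end

section
/- Let d, n be positive integers, let W be a d×n real matrix with nonnegative entries, let x ∈ ℝ^d have nonnegative entries, and let λ > 0, τ > 0, and 0 < z ≤ 1. Define L(h) = ‖x − Wh‖₂² + λ·Σ_{i=1}^n log(τ + h_i^z) on the nonnegative orthant {h ∈ ℝ^n : h_i ≥ 0 for all i}. If h* is a local minimum of L restricted to the nonnegative orthant, then the number of nonzero entries of h* is at most d. -/
open Matrix BigOperators

/-- Strict midpoint concavity of `u ↦ log (τ + u ^ z)` on the nonnegative half-line. -/
lemma log_add_rpow_midpoint_lt {τ z a s : ℝ} (hτ : 0 < τ) (hz0 : 0 < z) (hz1 : z ≤ 1)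
    (hs : s ≠ 0) (h1 : 0 ≤ a + s) (h2 : 0 ≤ a - s) :
    Real.log (τ + (a + s) ^ z) + Real.log (τ + (a - s) ^ z) < 2 * Real.log (τ + a ^ z) := by
  have hA : 0 < τ + (a + s) ^ z := by positivity
  have hB : 0 < τ + (a - s) ^ z := by positivity
  have hne : τ + (a + s) ^ z ≠ τ + (a - s) ^ z := by
    intro h
    have h' := (Real.rpow_left_inj h1 h2 hz0.ne').1 (add_left_cancel h)
    exact hs (by linarith)
  have hlog := strictConcaveOn_log_Ioi.2 (Set.mem_Ioi.2 hA) (Set.mem_Ioi.2 hB) hne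
    (by norm_num : (0 : ℝ) < 1 / 2) (by norm_num : (0 : ℝ) < 1 / 2) (by norm_num)
  have hpow := (Real.concaveOn_rpow hz0.le hz1).2 (Set.mem_Ici.2 h1) (Set.mem_Ici.2 h2)
    (by norm_num : (0 : ℝ) ≤ 1 / 2) (by norm_num : (0 : ℝ) ≤ 1 / 2) (by norm_num)
  simp only [smul_eq_mul] at hlog hpow
  rw [show 1 / 2 * (a + s) + 1 / 2 * (a - s) = a by ring] at hpow
  have hmono : Real.log (1 / 2 * (τ + (a + s) ^ z) + 1 / 2 * (τ + (a - s) ^ z))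
      ≤ Real.log (τ + a ^ z) :=
    Real.log_le_log (by positivity) (by linarith)
  linarith

/-- More columns than rows forces a nontrivial kernel vector supported on these columns. -/
lemma exists_mulVec_eq_zero_of_lt_card {d n : ℕ} (W : Matrix (Fin d) (Fin n) ℝ)
    (S : Finset (Fin n)) (hS : d < S.card) :
    ∃ v : Fin n → ℝ, W.mulVec v = 0 ∧ (∀ i, i ∉ S → v i = 0) ∧ ∃ i, v i ≠ 0 := by
  have hdep : ¬ LinearIndepOn ℝ (fun j i => W i j) (S : Set (Fin n)) := by
    intro h
    have := LinearIndependent.fintype_card_le_finrank h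
    simp at this
    omega
  rw [linearIndepOn_finset_iff] at hdep
  push Not at hdep
  obtain ⟨f, hf, i, hi, hfi⟩ := hdep
  refine ⟨fun j => if j ∈ S then f j else 0, ?_, fun j hj => by simp [hj], i, by simp [hi, hfi]⟩
  ext k
  have := congrFun hf k
  simpa [Matrix.mulVec, dotProduct, Finset.sum_apply, mul_comm] using this

/-- Small perturbations of a nonnegative vector within its support stay nonnegative. -/
lemma eventually_nonneg_add_smul {n : ℕ} {h v : Fin n → ℝ} (hh : ∀ i, 0 ≤ h i)
    (hv : ∀ i, h i = 0 → v i = 0) :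
    ∀ᶠ t : ℝ in nhds 0, ∀ i, 0 ≤ (h + t • v) i := by
  rw [Filter.eventually_all]
  intro i
  rcases (hh i).eq_or_lt with h0 | hpos
  · simp [← h0, hv i h0.symm]
  · have hc : Continuous fun t : ℝ => (h + t • v) i := by
      simp only [Pi.add_apply, Pi.smul_apply]
      fun_prop
    have := hc.tendsto 0
    exact (this.eventually (lt_mem_nhds (by simpa using hpos))).mono fun _ ht => le_of_lt ht

/-- Local minima of the MAP objective `L` on the nonnegative orthant are sparse:
they have at most `d` nonzero entries. -/
theorem stmt_4 (d n : ℕ) (hd : 0 < d) (hn : 0 < n)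
    (W : Matrix (Fin d) (Fin n) ℝ) (hW : ∀ i j, 0 ≤ W i j)
    (x : Fin d → ℝ) (hx : ∀ i, 0 ≤ x i)
    (lam τ z : ℝ) (hlam : 0 < lam) (hτ : 0 < τ) (hz0 : 0 < z) (hz1 : z ≤ 1)
    (L : (Fin n → ℝ) → ℝ)
    (hL : ∀ h, L h = ∑ i, (x i - W.mulVec h i) ^ 2 + lam * ∑ i, Real.log (τ + h i ^ z))
    (hstar : Fin n → ℝ) (hstarnn : ∀ i, 0 ≤ hstar i)
    (hmin : IsLocalMinOn L {h : Fin n → ℝ | ∀ i, 0 ≤ h i} hstar) :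
    (Finset.univ.filter fun i => hstar i ≠ 0).card ≤ d := by
  by_contra! hcard
  obtain ⟨v, hWv, hvS, j, hj⟩ := exists_mulVec_eq_zero_of_lt_card W _ hcard
  have hv : ∀ i, hstar i = 0 → v i = 0 := fun i hi => hvS i (by simp [hi])
  have hnn := eventually_nonneg_add_smul hstarnn hv
  have hc : Filter.Tendsto (fun t : ℝ => hstar + t • v) (nhds 0) (nhds hstar) := by
    have : Continuous fun t : ℝ => hstar + t • v := by fun_prop
    simpa using this.tendsto 0
  have hev : ∀ᶠ t : ℝ in nhds 0, (∀ i, 0 ≤ (hstar + t • v) i) ∧ L hstar ≤ L (hstar + t • v) := by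
    have hm := hc.eventually (eventually_nhdsWithin_iff.1 hmin)
    filter_upwards [hnn, hm] with t h1 h2 using ⟨h1, h2 h1⟩
  have hneg : Filter.Tendsto (fun t : ℝ => -t) (nhds 0) (nhds 0) := by
    simpa using (continuous_neg (G := ℝ)).tendsto 0
  obtain ⟨t, ⟨⟨hp, hLp⟩, hm, hLm⟩, ht⟩ :=
    (((hev.and (hneg.eventually hev)).filter_mono nhdsWithin_le_nhds).and
      (self_mem_nhdsWithin : Set.Ioi (0 : ℝ) ∈ nhdsWithin 0 (Set.Ioi 0))).exists
  have ht0 : t ≠ 0 := (Set.mem_Ioi.1 ht).ne'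
  simp only [hL, Matrix.mulVec_add, Matrix.mulVec_smul, hWv, smul_zero, add_zero,
    add_le_add_iff_left, mul_le_mul_iff_right₀ hlam] at hLp hLm
  simp only [Pi.add_apply, Pi.smul_apply, smul_eq_mul, neg_mul, ← sub_eq_add_neg]
    at hp hm hLp hLm
  have hlt : ∑ i, (Real.log (τ + (hstar i + t * v i) ^ z) + Real.log (τ + (hstar i - t * v i) ^ z))
      < ∑ i, 2 * Real.log (τ + hstar i ^ z) := by
    refine Finset.sum_lt_sum (fun i _ => ?_) ⟨j, Finset.mem_univ j,
      log_add_rpow_midpoint_lt hτ hz0 hz1 (mul_ne_zero ht0 hj) (hp j) (hm j)⟩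
    by_cases hi : v i = 0
    · simp [hi, two_mul]
    · exact (log_add_rpow_midpoint_lt hτ hz0 hz1 (mul_ne_zero ht0 hi) (hp i) (hm i)).le
  rw [Finset.sum_add_distrib, ← Finset.mul_sum] at hlt
  linarith
end

section
/- Let g : [0,∞) → ℝ be strictly concave, let W be a d×n real matrix, b ∈ ℝ^d, and let F = {h ∈ ℝ^n : h_i ≥ 0 for all i, and Wh = b}. If h* is a local minimum of the function h ↦ Σ_{i=1}^n g(h_i) restricted to F, then the columns of W indexed by the support {i : h*_i > 0} are linearly independent; in particular, the number of nonzero entries of h* is at most d. -/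
open Matrix BigOperators

open Filter Topology in
/-- A strictly concave function has no local minimum at a point through which a nontrivial
segment of the constraint set passes. -/
theorem IsLocalMinOn.eq_zero_of_strictConcaveOn {E : Type*} [AddCommGroup E] [Module ℝ E]
    [TopologicalSpace E] [ContinuousAdd E] [ContinuousSMul ℝ E] {f : E → ℝ} {s t : Set E}
    {x z : E} (hf : StrictConcaveOn ℝ t f) (hst : s ⊆ t) (hmin : IsLocalMinOn f s x)
    (hz : ∀ᶠ r : ℝ in 𝓝 0, x + r • z ∈ s) : z = 0 := by
  by_contra hz0
  have hline : Tendsto (fun r : ℝ => x + r • z) (𝓝 0) (𝓝 x) := by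
    have : Continuous fun r : ℝ => x + r • z := by fun_prop
    simpa using this.tendsto 0
  have hboth : ∀ᶠ r : ℝ in 𝓝 0, x + r • z ∈ s ∧ f x ≤ f (x + r • z) := by
    have := hline.eventually (eventually_nhdsWithin_iff.1 hmin)
    filter_upwards [hz, this] with r h₁ h₂ using ⟨h₁, h₂ h₁⟩
  have hneg : ∀ᶠ r : ℝ in 𝓝 0, x + (-r) • z ∈ s ∧ f x ≤ f (x + (-r) • z) :=
    (show Tendsto (fun r : ℝ => -r) (𝓝 0) (𝓝 0) by
      simpa using (continuous_neg (G := ℝ)).tendsto 0).eventually hboth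
  obtain ⟨r, ⟨⟨hs₁, hf₁⟩, hs₂, hf₂⟩, hr⟩ :=
    (((hboth.and hneg).filter_mono nhdsWithin_le_nhds).and
      (self_mem_nhdsWithin : Set.Ioi (0 : ℝ) ∈ 𝓝[>] 0)).exists
  have hr : 0 < r := hr
  have hne : x + r • z ≠ x + (-r) • z := by
    intro h
    have h₂ : (r + r) • z = 0 := by
      rw [add_smul, ← sub_neg_eq_add, ← neg_smul, add_left_cancel h, sub_self]
    exact (smul_ne_zero (by positivity) hz0) h₂
  have hlt := hf.2 (hst hs₁) (hst hs₂) hne (show (0 : ℝ) < 1 / 2 by norm_num)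
    (show (0 : ℝ) < 1 / 2 by norm_num) (by norm_num)
  have hmid : (1 / 2 : ℝ) • (x + r • z) + (1 / 2 : ℝ) • (x + (-r) • z) = x := by module
  rw [hmid] at hlt
  simp only [smul_eq_mul] at hlt
  linarith

/-- A separable sum of copies of a strictly concave function is strictly concave. -/
theorem StrictConcaveOn.sum_apply {ι : Type*} [Fintype ι] {s : Set ℝ} {g : ℝ → ℝ}
    (hg : StrictConcaveOn ℝ s g) :
    StrictConcaveOn ℝ (Set.univ.pi fun _ : ι => s) (fun h => ∑ i, g (h i)) := by
  refine ⟨convex_pi fun _ _ => hg.1, fun x hx y hy hxy a b ha hb hab => ?_⟩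
  obtain ⟨j, hj⟩ := Function.ne_iff.1 hxy
  simp only [smul_eq_mul, Finset.mul_sum, ← Finset.sum_add_distrib]
  exact Finset.sum_lt_sum
    (fun i _ => hg.concaveOn.2 (hx i trivial) (hy i trivial) ha.le hb.le hab)
    ⟨j, Finset.mem_univ j, hg.2 (hx j trivial) (hy j trivial) hj ha hb hab⟩

open Filter Topology in
/-- Small perturbations supported where a nonnegative vector is positive keep it nonnegative. -/
theorem eventually_forall_nonneg_add_smul {ι : Type*} [Finite ι] {h z : ι → ℝ}
    (hh : ∀ i, 0 ≤ h i) (hz : ∀ i, ¬ 0 < h i → z i = 0) :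
    ∀ᶠ r : ℝ in 𝓝 0, ∀ i, 0 ≤ (h + r • z) i := by
  refine eventually_all.2 fun i => ?_
  by_cases hi : 0 < h i
  · have hc : Continuous fun r : ℝ => (h + r • z) i := by
      simp only [Pi.add_apply, Pi.smul_apply]
      fun_prop
    exact ((hc.tendsto 0).eventually_const_lt (by simpa using hi)).mono fun _ => le_of_lt
  · simp [hz i hi, hh i]

/-- Local minima of a separable strictly concave diversity measure over the
feasible polyhedron `{h ≥ 0 : W h = b}` are basic feasible solutions: the columns
of `W` on the support are linearly independent, so the support has size at most `d`. -/
theorem stmt_6 (d n : ℕ) (g : ℝ → ℝ)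
    (hg : StrictConcaveOn ℝ (Set.Ici (0 : ℝ)) g)
    (W : Matrix (Fin d) (Fin n) ℝ) (b : Fin d → ℝ)
    (F : Set (Fin n → ℝ))
    (hF : F = {h : Fin n → ℝ | (∀ i, 0 ≤ h i) ∧ W.mulVec h = b})
    (hstar : Fin n → ℝ) (hstarF : hstar ∈ F)
    (hmin : IsLocalMinOn (fun h : Fin n → ℝ => ∑ i, g (h i)) F hstar) :
    LinearIndependent ℝ (fun i : {i : Fin n // 0 < hstar i} => Wᵀ i.1) ∧
      (Finset.univ.filter fun i => hstar i ≠ 0).card ≤ d := by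
  subst hF
  obtain ⟨hpos, hb⟩ := hstarF
  have hli : LinearIndependent ℝ (fun i : {i : Fin n // 0 < hstar i} => Wᵀ i.1) := by
    refine Fintype.linearIndependent_iff.2 fun c hc => ?_
    set z : Fin n → ℝ := fun i => if hi : 0 < hstar i then c ⟨i, hi⟩ else 0 with hzdef
    have hzoff : ∀ i, ¬ 0 < hstar i → z i = 0 := fun i hi => dif_neg hi
    have hzon : ∀ i : {i : Fin n // 0 < hstar i}, z i = c i := fun i => dif_pos i.2
    have hWz : W *ᵥ z = 0 := by
      rw [mulVec_eq_sum, ← hc, ← Fintype.sum_subtype_add_sum_subtype (fun i => 0 < hstar i)]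
      simp only [hzon]
      rw [Finset.sum_eq_zero (s := Finset.univ (α := {i // ¬ 0 < hstar i}))
        fun i _ => by simp [hzoff i i.2], add_zero]
      simp
    have hz : z = 0 := by
      refine hmin.eq_zero_of_strictConcaveOn hg.sum_apply (fun h hh i _ => hh.1 i) ?_
      filter_upwards [eventually_forall_nonneg_add_smul hpos hzoff] with r hr
      exact ⟨hr, by rw [mulVec_add, mulVec_smul, hWz, smul_zero, add_zero, hb]⟩
    intro i
    rw [← hzon, hz, Pi.zero_apply]
  refine ⟨hli, ?_⟩
  have hcard := hli.fintype_card_le_finrank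
  rw [Module.finrank_fin_fun, Fintype.card_subtype] at hcard
  simpa only [(hpos _).lt_iff_ne'] using hcard
end

section
/- Let W be a d×n real matrix with nonnegative entries, x ∈ ℝ^d with nonnegative entries, λ > 0, and τ > 0 with 2τ·max_i (Wᵀx)_i ≤ λ. Suppose h̄ ∈ ℝ^n has nonnegative entries and is a fixed point of the reweighted ℓ₁ multiplicative update, i.e., for every i with h̄_i > 0, (Wᵀx)_i = (WᵀWh̄)_i + λ/(2(τ + h̄_i)). Then h̄ satisfies the Karush–Kuhn–Tucker conditions for minimizing L(h) = ‖x − Wh‖₂² + λ·Σ_{i=1}^n log(τ + h_i) over the nonnegative orthant: for every i, (WᵀWh̄)_i − (Wᵀx)_i + λ/(2(τ + h̄_i)) ≥ 0, and this quantity equals 0 whenever h̄_i > 0. -/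
open Matrix BigOperators

/-- A fixed point of the reweighted ℓ₁ multiplicative update satisfies the KKT
conditions for minimizing the reweighted ℓ₁ S-NNLS objective over the
nonnegative orthant. -/
theorem stmt_11 (d n : ℕ)
    (W : Matrix (Fin d) (Fin n) ℝ) (hW : ∀ i j, 0 ≤ W i j)
    (x : Fin d → ℝ) (hx : ∀ i, 0 ≤ x i)
    (lam τ : ℝ) (hlam : 0 < lam) (hτ : 0 < τ)
    (hτlam : ∀ i, 2 * τ * Wᵀ.mulVec x i ≤ lam)
    (hbar : Fin n → ℝ) (hbarnn : ∀ i, 0 ≤ hbar i)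
    (hfix : ∀ i, 0 < hbar i →
      Wᵀ.mulVec x i = (Wᵀ * W).mulVec hbar i + lam / (2 * (τ + hbar i))) :
    ∀ i, 0 ≤ (Wᵀ * W).mulVec hbar i - Wᵀ.mulVec x i + lam / (2 * (τ + hbar i)) ∧
      (0 < hbar i →
        (Wᵀ * W).mulVec hbar i - Wᵀ.mulVec x i + lam / (2 * (τ + hbar i)) = 0) := by
  intro i
  rcases (hbarnn i).eq_or_lt with h0 | hpos
  · refine ⟨?_, fun hpos => absurd h0 hpos.ne⟩
    have hgram : 0 ≤ (Wᵀ * W).mulVec hbar i := by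
      simp only [mulVec, dotProduct, mul_apply, transpose_apply]
      exact Finset.sum_nonneg fun j _ =>
        mul_nonneg (Finset.sum_nonneg fun k _ => mul_nonneg (hW k i) (hW k j)) (hbarnn j)
    have hcorr : Wᵀ.mulVec x i ≤ lam / (2 * (τ + hbar i)) := by
      rw [← h0, add_zero, le_div_iff₀ (by positivity)]
      linarith [hτlam i]
    linarith
  · have hzero : (Wᵀ * W).mulVec hbar i - Wᵀ.mulVec x i + lam / (2 * (τ + hbar i)) = 0 := by
      linarith [hfix i hpos]
    exact ⟨hzero.ge, fun _ => hzero⟩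
end

section
/- For every τ > 0 and every h ≥ 0, ∫₀^∞ √(2/(π·γ))·exp(−h²/(2γ)) · (τ²/2)·exp(−(τ²/2)·γ) dγ = τ·exp(−τ·h). That is, the rectified Gaussian density with scale γ, mixed over γ with an Exponential(τ²/2) mixing density, yields the Exponential density with rate τ. -/
open MeasureTheory Set Filter Topology

/-- The fundamental theorem of calculus on `(a, +∞)` for a function with nonnegative derivative
which has limits at `a⁺` and at infinity. -/
theorem integral_Ioi_of_hasDerivAt_of_nonneg_of_tendsto {g g' : ℝ → ℝ} {a k l : ℝ}
    (hga : Tendsto g (𝓝[>] a) (𝓝 k)) (hderiv : ∀ x ∈ Ioi a, HasDerivAt g (g' x) x)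
    (g'pos : ∀ x ∈ Ioi a, 0 ≤ g' x) (hg : Tendsto g atTop (𝓝 l)) :
    ∫ x in Ioi a, g' x = l - k := by
  have hcont : ContinuousWithinAt (Function.update g a k) (Ici a) a := by
    rw [continuousWithinAt_update_same, Ici_sdiff_left]
    exact hga
  have heq : ∀ x ∈ Ioi a, Function.update g a k =ᶠ[𝓝 x] g := fun x hx => by
    filter_upwards [Ioi_mem_nhds hx] with y hy
    exact Function.update_of_ne (ne_of_gt hy) _ _
  have hlim : Tendsto (Function.update g a k) atTop (𝓝 l) := by
    refine hg.congr' ?_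
    filter_upwards [Ioi_mem_atTop a] with y hy
    exact (Function.update_of_ne (ne_of_gt hy) _ _).symm
  simpa using integral_Ioi_of_hasDerivAt_of_nonneg hcont
    (fun x hx => (hderiv x hx).congr_of_eventuallyEq (heq x hx)) g'pos hlim

/-- The primitive of `t ↦ exp (-t ^ 2 / 2)` vanishing at `0`. -/
noncomputable def gaussianPrimitive (x : ℝ) : ℝ := ∫ t in (0 : ℝ)..x, Real.exp (-(1 / 2) * t ^ 2)

theorem hasDerivAt_gaussianPrimitive (x : ℝ) :
    HasDerivAt gaussianPrimitive (Real.exp (-(1 / 2) * x ^ 2)) x := by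
  have hc : Continuous fun t : ℝ => Real.exp (-(1 / 2) * t ^ 2) := by fun_prop
  exact hc.integral_hasStrictDerivAt 0 x |>.hasDerivAt

theorem gaussianPrimitive_neg (x : ℝ) : gaussianPrimitive (-x) = -gaussianPrimitive x := by
  have := intervalIntegral.integral_comp_neg (a := 0) (b := x)
    fun t : ℝ => Real.exp (-(1 / 2) * t ^ 2)
  simp only [neg_sq, neg_zero] at this
  rw [gaussianPrimitive, gaussianPrimitive, this, intervalIntegral.integral_symm]

theorem tendsto_gaussianPrimitive_atTop :
    Tendsto gaussianPrimitive atTop (𝓝 (√(2 * Real.pi) / 2)) := by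
  have := intervalIntegral_tendsto_integral_Ioi 0
    (integrable_exp_neg_mul_sq (b := 1 / 2) (by norm_num)).integrableOn tendsto_id
  rwa [integral_gaussian_Ioi, show Real.pi / (1 / 2) = 2 * Real.pi by ring] at this

theorem tendsto_gaussianPrimitive_atBot :
    Tendsto gaussianPrimitive atBot (𝓝 (-(√(2 * Real.pi) / 2))) := by
  refine (tendsto_gaussianPrimitive_atTop.comp tendsto_neg_atBot_atTop).neg.congr fun x => ?_
  simp [gaussianPrimitive_neg]

/-- A primitive of `x ↦ 2 * τ * exp (-(τ ^ 2 * x ^ 2 + h ^ 2 / x ^ 2) / 2)` on `(0, +∞)`. -/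
noncomputable def mixturePrimitive (τ h x : ℝ) : ℝ :=
  Real.exp (-τ * h) * gaussianPrimitive (τ * x - h * x⁻¹) +
    Real.exp (τ * h) * gaussianPrimitive (τ * x + h * x⁻¹)

theorem hasDerivAt_mixturePrimitive (τ h : ℝ) {x : ℝ} (hx : x ≠ 0) :
    HasDerivAt (mixturePrimitive τ h)
      (2 * τ * Real.exp (-(τ ^ 2 * x ^ 2 + h ^ 2 / x ^ 2) / 2)) x := by
  have hτx : HasDerivAt (fun y : ℝ => τ * y) τ x := by
    simpa using (hasDerivAt_id x).const_mul τ
  have hinv : HasDerivAt (fun y : ℝ => h * y⁻¹) (h * -(x ^ 2)⁻¹) x :=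
    (hasDerivAt_inv hx).const_mul h
  have hu := ((hasDerivAt_gaussianPrimitive (τ * x - h * x⁻¹)).comp x
    (hτx.sub hinv)).const_mul (Real.exp (-τ * h))
  have hv := ((hasDerivAt_gaussianPrimitive (τ * x + h * x⁻¹)).comp x
    (hτx.add hinv)).const_mul (Real.exp (τ * h))
  refine (hu.add hv).congr_deriv ?_
  rw [← mul_assoc, ← mul_assoc, ← Real.exp_add, ← Real.exp_add,
    show -τ * h + -(1 / 2) * (τ * x - h * x⁻¹) ^ 2 = -(τ ^ 2 * x ^ 2 + h ^ 2 / x ^ 2) / 2 by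
      field_simp; ring,
    show τ * h + -(1 / 2) * (τ * x + h * x⁻¹) ^ 2 = -(τ ^ 2 * x ^ 2 + h ^ 2 / x ^ 2) / 2 by
      field_simp; ring]
  ring

theorem tendsto_mixturePrimitive_atTop {τ : ℝ} (hτ : 0 < τ) (h : ℝ) :
    Tendsto (mixturePrimitive τ h) atTop
      (𝓝 (Real.exp (-τ * h) * (√(2 * Real.pi) / 2) + Real.exp (τ * h) * (√(2 * Real.pi) / 2))) := by
  have hτx : Tendsto (fun x : ℝ => τ * x) atTop atTop := tendsto_id.const_mul_atTop hτ
  have hinv : Tendsto (fun x : ℝ => h * x⁻¹) atTop (𝓝 (h * 0)) :=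
    tendsto_inv_atTop_zero.const_mul h
  refine ((tendsto_gaussianPrimitive_atTop.comp ?_).const_mul _).add
    ((tendsto_gaussianPrimitive_atTop.comp (hτx.atTop_add hinv)).const_mul _)
  simpa only [sub_eq_add_neg] using hτx.atTop_add hinv.neg

theorem tendsto_mixturePrimitive_zero (τ : ℝ) {h : ℝ} (hh : 0 ≤ h) :
    Tendsto (mixturePrimitive τ h) (𝓝[>] 0)
      (𝓝 (Real.exp (τ * h) * (√(2 * Real.pi) / 2) - Real.exp (-τ * h) * (√(2 * Real.pi) / 2))) := by
  have hτx : Tendsto (fun x : ℝ => τ * x) (𝓝[>] 0) (𝓝 (τ * 0)) :=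
    (tendsto_id.mono_left nhdsWithin_le_nhds).const_mul τ
  rcases hh.eq_or_lt with rfl | hpos
  · have h0 : Tendsto (fun x : ℝ => gaussianPrimitive (τ * x)) (𝓝[>] 0) (𝓝 0) := by
      have := (hasDerivAt_gaussianPrimitive (τ * 0)).continuousAt.tendsto.comp hτx
      simpa [Function.comp_def, gaussianPrimitive] using this
    have := h0.add h0
    have heq : mixturePrimitive τ 0 =
        fun x => gaussianPrimitive (τ * x) + gaussianPrimitive (τ * x) := by
      ext x
      simp [mixturePrimitive]
    simpa [heq] using this
  · have hinv : Tendsto (fun x : ℝ => h * x⁻¹) (𝓝[>] 0) atTop :=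
      tendsto_inv_nhdsGT_zero.const_mul_atTop hpos
    have hu : Tendsto (fun x : ℝ => τ * x - h * x⁻¹) (𝓝[>] 0) atBot := by
      simpa only [sub_eq_add_neg, Function.comp_apply] using hτx.add_atBot (tendsto_neg_atTop_atBot.comp hinv)
    have := ((tendsto_gaussianPrimitive_atBot.comp hu).const_mul (Real.exp (-τ * h))).add
      ((tendsto_gaussianPrimitive_atTop.comp (hτx.add_atTop hinv)).const_mul (Real.exp (τ * h)))
    rwa [mul_neg, neg_add_eq_sub] at this

/-- The rectified Gaussian density mixed over its scale with an
Exponential(τ²/2) mixing density yields the Exponential density with rate τ. -/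
theorem stmt_12 (τ : ℝ) (hτ : 0 < τ) (h : ℝ) (hh : 0 ≤ h) :
    ∫ γ in Set.Ioi (0 : ℝ),
      Real.sqrt (2 / (Real.pi * γ)) * Real.exp (-h ^ 2 / (2 * γ)) *
        (τ ^ 2 / 2 * Real.exp (-(τ ^ 2 / 2) * γ))
      = τ * Real.exp (-τ * h) := by
  have hpi : 0 < √(2 * Real.pi) := by positivity
  have hsqrt : Tendsto Real.sqrt (𝓝[>] 0) (𝓝[>] 0) := by
    refine tendsto_nhdsWithin_iff.2 ⟨?_, ?_⟩
    · simpa using (Real.continuous_sqrt.tendsto 0).mono_left nhdsWithin_le_nhds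
    · filter_upwards [self_mem_nhdsWithin] with x hx using Real.sqrt_pos.2 hx
  rw [integral_Ioi_of_hasDerivAt_of_nonneg_of_tendsto
    (g := fun γ => τ / √(2 * Real.pi) * mixturePrimitive τ h √γ)
    (((tendsto_mixturePrimitive_zero τ hh).comp hsqrt).const_mul _) ?_
    (fun γ _ => by positivity)
    (((tendsto_mixturePrimitive_atTop hτ h).comp Real.tendsto_sqrt_atTop).const_mul _)]
  · field_simp
    ring
  · intro γ hγ
    have hγ : 0 < γ := hγ
    have hs : 0 < √γ := Real.sqrt_pos.2 hγ
    refine (((hasDerivAt_mixturePrimitive τ h hs.ne').comp γ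
      (Real.hasDerivAt_sqrt hγ.ne')).const_mul _).congr_deriv ?_
    have hcoef : √(2 / (Real.pi * γ)) = 2 / (√(2 * Real.pi) * √γ) := by
      rw [← Real.sqrt_mul (by positivity),
        show 2 / (Real.pi * γ) = 2 ^ 2 / (2 * Real.pi * γ) by field_simp,
        Real.sqrt_div (by positivity), Real.sqrt_sq (by norm_num)]
    have hexp : Real.exp (-h ^ 2 / (2 * γ)) * Real.exp (-(τ ^ 2 / 2) * γ) =
        Real.exp (-(τ ^ 2 * γ + h ^ 2 / γ) / 2) := by
      rw [← Real.exp_add]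
      congr 1
      field_simp
      ring
    rw [Real.sq_sqrt hγ.le, ← hexp, hcoef]
    field_simp
end

section
/- Let W be a d×n real matrix with nonnegative entries, x ∈ ℝ^d with nonnegative entries, and λ > 0, τ > 0. Define L(h) = ‖x − Wh‖₂² + λ·Σ_{i=1}^n log(τ + h_i). Let h̄ ∈ ℝ^n have strictly positive entries, suppose each denominator (WᵀWh̄)_i + λ/(2(τ + h̄_i)) is strictly positive, and define the reweighted ℓ₁ multiplicative update h⁺_i = h̄_i·(Wᵀx)_i / ((WᵀWh̄)_i + λ/(2(τ + h̄_i))). Then every entry of h⁺ is nonnegative and L(h⁺) ≤ L(h̄). -/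
open Matrix BigOperators

/-- The diagonal majorizer of the Gram matrix `Wᵀ * W` of a nonnegative matrix at a positive
vector `b`. -/
lemma sum_sq_mulVec_le_sum_gram_div {m n : Type*} [Fintype m] [Fintype n]
    (W : Matrix m n ℝ) (hW : ∀ i j, 0 ≤ W i j)
    (b : n → ℝ) (hb : ∀ j, 0 < b j) (v : n → ℝ) :
    ∑ i, (W.mulVec v i) ^ 2 ≤ ∑ j, (Wᵀ * W).mulVec b j * (v j ^ 2 / b j) := by
  calc ∑ i, (W.mulVec v i) ^ 2
      ≤ ∑ i, W.mulVec b i * W.mulVec (fun j => v j ^ 2 / b j) i := by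
        refine Finset.sum_le_sum fun i _ => ?_
        refine Finset.sum_sq_le_sum_mul_sum_of_sq_le_mul _
          (fun j _ => mul_nonneg (hW i j) (hb j).le)
          (fun j _ => mul_nonneg (hW i j) (div_nonneg (sq_nonneg _) (hb j).le)) fun j _ => Eq.le ?_
        have := (hb j).ne'
        field_simp
    _ = ∑ j, (Wᵀ * W).mulVec b j * (v j ^ 2 / b j) := by
        change W.mulVec b ⬝ᵥ W.mulVec _ = (Wᵀ * W).mulVec b ⬝ᵥ _
        rw [dotProduct_mulVec, ← mulVec_transpose, mulVec_mulVec]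

/-- The least-squares residual at `p` expanded around `b`. -/
lemma sum_sq_sub_mulVec_eq {m n : Type*} [Fintype m] [Fintype n]
    (W : Matrix m n ℝ) (x : m → ℝ) (b p : n → ℝ) :
    ∑ i, (x i - W.mulVec p i) ^ 2 = ∑ i, (x i - W.mulVec b i) ^ 2
      - 2 * ∑ j, (Wᵀ.mulVec x j - (Wᵀ * W).mulVec b j) * (p j - b j)
      + ∑ i, (W.mulVec (p - b) i) ^ 2 := by
  have h : ∑ j, (Wᵀ.mulVec x j - (Wᵀ * W).mulVec b j) * (p j - b j)
      = ∑ i, (x i - W.mulVec b i) * W.mulVec (p - b) i := by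
    change (Wᵀ.mulVec x - (Wᵀ * W).mulVec b) ⬝ᵥ (p - b) = (x - W.mulVec b) ⬝ᵥ W.mulVec (p - b)
    rw [dotProduct_mulVec, ← mulVec_transpose, mulVec_sub, mulVec_mulVec]
  rw [h, Finset.mul_sum, ← Finset.sum_sub_distrib, ← Finset.sum_add_distrib]
  refine Finset.sum_congr rfl fun i _ => ?_
  rw [mulVec_sub, Pi.sub_apply]
  ring

/-- The tangent-line bound for the concave function `Real.log`. -/
lemma Real.log_le_log_add_sub_div {s t : ℝ} (hs : 0 < s) (ht : 0 < t) :
    Real.log t ≤ Real.log s + (t - s) / s := by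
  have h := Real.log_le_sub_one_of_pos (div_pos ht hs)
  rw [Real.log_div ht.ne' hs.ne'] at h
  rw [sub_div, div_self hs.ne']
  linarith

/-- The reweighted ℓ₁ multiplicative update preserves non-negativity and does not
increase the reweighted ℓ₁ S-NNLS objective. -/
theorem stmt_15 (d n : ℕ)
    (W : Matrix (Fin d) (Fin n) ℝ) (hW : ∀ i j, 0 ≤ W i j)
    (x : Fin d → ℝ) (hx : ∀ i, 0 ≤ x i)
    (lam τ : ℝ) (hlam : 0 < lam) (hτ : 0 < τ)
    (L : (Fin n → ℝ) → ℝ)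
    (hL : ∀ h, L h = ∑ i, (x i - W.mulVec h i) ^ 2 + lam * ∑ i, Real.log (τ + h i))
    (hbar : Fin n → ℝ) (hpos : ∀ i, 0 < hbar i)
    (hden : ∀ i, 0 < (Wᵀ * W).mulVec hbar i + lam / (2 * (τ + hbar i)))
    (hplus : Fin n → ℝ)
    (hplusdef : ∀ i, hplus i =
      hbar i * Wᵀ.mulVec x i / ((Wᵀ * W).mulVec hbar i + lam / (2 * (τ + hbar i)))) :
    (∀ i, 0 ≤ hplus i) ∧ L hplus ≤ L hbar := by
  have hnonneg : ∀ i, 0 ≤ hplus i := fun i => by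
    rw [hplusdef]
    have hc : 0 ≤ Wᵀ.mulVec x i :=
      dotProduct_nonneg_of_nonneg (fun k => hW k i) hx
    exact div_nonneg (mul_nonneg (hpos i).le hc) (hden i).le
  refine ⟨hnonneg, ?_⟩
  have hlog : lam * ∑ i, Real.log (τ + hplus i) ≤ lam * ∑ i, Real.log (τ + hbar i)
      + ∑ i, 2 * (lam / (2 * (τ + hbar i))) * (hplus i - hbar i) := by
    rw [Finset.mul_sum, Finset.mul_sum, ← Finset.sum_add_distrib]
    refine Finset.sum_le_sum fun i _ => ?_
    have hs : 0 < τ + hbar i := add_pos hτ (hpos i)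
    have h := mul_le_mul_of_nonneg_left (Real.log_le_log_add_sub_div hs
      (add_pos_of_pos_of_nonneg hτ (hnonneg i))) hlam.le
    refine h.trans_eq ?_
    field_simp
    ring
  have hquad := sum_sq_mulVec_le_sum_gram_div W hW hbar hpos (hplus - hbar)
  have hsum : ∑ i, (2 * (lam / (2 * (τ + hbar i))) * (hplus i - hbar i)
      - 2 * ((Wᵀ.mulVec x i - (Wᵀ * W).mulVec hbar i) * (hplus i - hbar i))
      + (Wᵀ * W).mulVec hbar i * ((hplus - hbar) i ^ 2 / hbar i)) ≤ 0 := by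
    refine Finset.sum_nonpos fun i _ => ?_
    have hb := hpos i
    have hw : 0 < lam / (2 * (τ + hbar i)) :=
      div_pos hlam (mul_pos two_pos (add_pos hτ hb))
    have hD := hden i
    have hp := hplusdef i
    rw [eq_div_iff hD.ne'] at hp
    rw [Pi.sub_apply]
    generalize lam / (2 * (τ + hbar i)) = w at *
    generalize (Wᵀ * W).mulVec hbar i = a at *
    have hc : Wᵀ.mulVec x i = hplus i * (a + w) / hbar i := by
      rw [eq_div_iff hb.ne', hp, mul_comm]
    rw [hc]
    have key : 2 * w * (hplus i - hbar i)
        - 2 * ((hplus i * (a + w) / hbar i - a) * (hplus i - hbar i))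
        + a * ((hplus i - hbar i) ^ 2 / hbar i)
        = -((a + w + w) * ((hplus i - hbar i) ^ 2 / hbar i)) := by
      field_simp
      ring
    rw [key, neg_nonpos]
    positivity
  rw [Finset.sum_add_distrib, Finset.sum_sub_distrib] at hsum
  rw [hL, hL, sum_sq_sub_mulVec_eq W x hbar hplus, Finset.mul_sum Finset.univ _ (2 : ℝ)]
  linarith
end

section
/- Let X be a d×m real matrix with nonnegative entries, let λ_w, λ_h, τ_w, τ_h > 0, and define, for a d×n matrix W and an n×m matrix H with nonnegative entries, L^{NMF}(W,H) = ‖X − WH‖_F² + λ_w·Σ_{i,j} log(τ_w + W_{ij}) + λ_h·Σ_{i,j} log(τ_h + H_{ij}). Let W^t and H^t have strictly positive entries. Define the alternating multiplicative updates W⁺_{ij} = W^t_{ij}·(X(H^t)ᵀ)_{ij} / ((W^t H^t (H^t)ᵀ)_{ij} + λ_w/(2(τ_w + W^t_{ij}))) and then H⁺_{ij} = H^t_{ij}·((W⁺)ᵀX)_{ij} / (((W⁺)ᵀW⁺H^t)_{ij} + λ_h/(2(τ_h + H^t_{ij}))), assuming all denominators are strictly positive. Then L^{NMF}(W⁺,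 H⁺) ≤ L^{NMF}(W⁺, H^t) ≤ L^{NMF}(W^t, H^t). -/
open Matrix BigOperators

/-- The diagonal majorizer of the Gram form of a nonnegative matrix `A`. -/
theorem sum_sq_sum_mul_le {ι κ : Type*} [Fintype ι] [Fintype κ] (A : ι → κ → ℝ)
    (hA : ∀ i k, 0 ≤ A i k) (h δ : κ → ℝ) (hh : ∀ k, 0 < h k) :
    ∑ i, (∑ k, A i k * δ k) ^ 2 ≤
      ∑ k, (∑ i, A i k * ∑ l, A i l * h l) * (δ k ^ 2 / h k) := by
  have key : ∀ i, (∑ k, A i k * δ k) ^ 2 ≤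
      (∑ k, A i k * (δ k ^ 2 / h k)) * ∑ l, A i l * h l := fun i => by
    refine Finset.sum_sq_le_sum_mul_sum_of_sq_le_mul _ (fun k _ => ?_) (fun k _ => ?_)
      (fun k _ => ?_)
    · exact mul_nonneg (hA i k) (div_nonneg (sq_nonneg _) (hh k).le)
    · exact mul_nonneg (hA i k) (hh k).le
    · refine le_of_eq ?_
      have := (hh k).ne'
      field_simp
  refine (Finset.sum_le_sum fun i _ => key i).trans_eq ?_
  simp_rw [Finset.sum_mul]
  rw [Finset.sum_comm]
  exact Finset.sum_congr rfl fun k _ => Finset.sum_congr rfl fun i _ => by ring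

/-- One reweighted `ℓ₁` multiplicative update of the coefficient vector `h` in `x ≈ A h`
does not increase the log-penalized least-squares objective. -/
theorem reweighted_multiplicative_update_le {ι κ : Type*} [Fintype ι] [Fintype κ]
    (A : ι → κ → ℝ) (hA : ∀ i k, 0 ≤ A i k) (x : ι → ℝ) (hx : ∀ i, 0 ≤ x i)
    {lam τ : ℝ} (hlam : 0 < lam) (hτ : 0 < τ) (h h' : κ → ℝ) (hh : ∀ k, 0 < h k)
    (hh' : ∀ k, h' k = h k * (∑ i, A i k * x i) /
      ((∑ i, A i k * ∑ l, A i l * h l) + lam / (2 * (τ + h k)))) :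
    ∑ i, (x i - ∑ k, A i k * h' k) ^ 2 + lam * ∑ k, Real.log (τ + h' k) ≤
      ∑ i, (x i - ∑ k, A i k * h k) ^ 2 + lam * ∑ k, Real.log (τ + h k) := by
  set b : κ → ℝ := fun k => ∑ i, A i k * x i with hb
  set c : κ → ℝ := fun k => ∑ i, A i k * ∑ l, A i l * h l with hc
  set r : κ → ℝ := fun k => lam / (2 * (τ + h k)) with hr
  set δ : κ → ℝ := fun k => h' k - h k with hδ
  have hb0 : ∀ k, 0 ≤ b k := fun k => Finset.sum_nonneg fun i _ => mul_nonneg (hA i k) (hx i)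
  have hc0 : ∀ k, 0 ≤ c k := fun k => Finset.sum_nonneg fun i _ =>
    mul_nonneg (hA i k) (Finset.sum_nonneg fun l _ => mul_nonneg (hA i l) (hh l).le)
  have hr0 : ∀ k, 0 < r k := fun k => by have := hh k; simp only [hr]; positivity
  have hh'0 : ∀ k, 0 ≤ h' k := fun k => by
    rw [hh' k]
    exact div_nonneg (mul_nonneg (hh k).le (hb0 k)) (add_nonneg (hc0 k) (hr0 k).le)
  have hupd : ∀ k, (c k + r k) * (δ k / h k) = b k - c k - r k := fun k => by
    have h1 : c k + r k ≠ 0 := (add_pos_of_nonneg_of_pos (hc0 k) (hr0 k)).ne'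
    have h2 := (hh k).ne'
    have h3 : h' k = h k * b k / (c k + r k) := hh' k
    simp only [hδ]
    rw [h3]
    field_simp
    ring
  have hlog : ∀ k, lam * Real.log (τ + h' k) ≤ lam * Real.log (τ + h k) + 2 * r k * δ k :=
    fun k => by
    have h1 : 0 < τ + h k := add_pos hτ (hh k)
    have h2 : 0 < τ + h' k := add_pos_of_pos_of_nonneg hτ (hh'0 k)
    have h3 := Real.log_le_sub_one_of_pos (div_pos h2 h1)
    rw [Real.log_div h2.ne' h1.ne'] at h3
    have h4 : 2 * r k * δ k = lam * ((τ + h' k) / (τ + h k) - 1) := by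
      simp only [hr, hδ]
      field_simp
      ring
    rw [h4]
    nlinarith [mul_le_mul_of_nonneg_left h3 hlam.le]
  have hexp : ∑ i, (x i - ∑ k, A i k * h' k) ^ 2 =
      ∑ i, (x i - ∑ k, A i k * h k) ^ 2 - 2 * ∑ k, (b k - c k) * δ k +
        ∑ i, (∑ k, A i k * δ k) ^ 2 := by
    have h1 : ∑ k, (b k - c k) * δ k =
        ∑ i, (x i - ∑ k, A i k * h k) * ∑ k, A i k * δ k := by
      have h2 : ∀ k, (b k - c k) * δ k =
          ∑ i, (x i - ∑ l, A i l * h l) * (A i k * δ k) := fun k => by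
        simp only [hb, hc]
        rw [← Finset.sum_sub_distrib, Finset.sum_mul]
        exact Finset.sum_congr rfl fun i _ => by ring
      rw [Finset.sum_congr rfl fun k _ => h2 k, Finset.sum_comm]
      exact Finset.sum_congr rfl fun i _ => (Finset.mul_sum _ _ _).symm
    rw [h1, Finset.mul_sum, ← Finset.sum_sub_distrib, ← Finset.sum_add_distrib]
    refine Finset.sum_congr rfl fun i _ => ?_
    have h2 : ∑ k, A i k * δ k = ∑ k, A i k * h' k - ∑ k, A i k * h k := by
      simp only [hδ, mul_sub, Finset.sum_sub_distrib]
    rw [h2]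
    ring
  have hquad : ∑ i, (∑ k, A i k * δ k) ^ 2 ≤ ∑ k, c k * (δ k ^ 2 / h k) :=
    sum_sq_sum_mul_le A hA h δ hh
  have hpen := Finset.sum_le_sum fun k (_ : k ∈ Finset.univ) => hlog k
  have hdesc : ∑ k, (c k * (δ k ^ 2 / h k) - 2 * ((b k - c k) * δ k) + 2 * r k * δ k) ≤ 0 := by
    refine Finset.sum_nonpos fun k _ => ?_
    have h1 : 0 ≤ δ k ^ 2 / h k := div_nonneg (sq_nonneg _) (hh k).le
    have h2 : (c k + r k) * (δ k ^ 2 / h k) = (b k - c k - r k) * δ k := by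
      rw [← hupd k]
      ring
    nlinarith [mul_nonneg (hc0 k) h1, mul_nonneg (hr0 k).le h1]
  rw [← Finset.mul_sum, Finset.sum_add_distrib, ← Finset.mul_sum] at hpen
  rw [Finset.sum_add_distrib, Finset.sum_sub_distrib, ← Finset.mul_sum] at hdesc
  linarith

/-- The alternating reweighted ℓ₁ multiplicative updates for sparse NMF with
sparsity on both factors (S-NMF-W) do not increase the objective `L^{NMF}`:
each half-step is monotone. -/
theorem stmt_19 (d n m : ℕ)
    (X : Matrix (Fin d) (Fin m) ℝ) (hX : ∀ i j, 0 ≤ X i j)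
    (lw lh τw τh : ℝ) (hlw : 0 < lw) (hlh : 0 < lh) (hτw : 0 < τw) (hτh : 0 < τh)
    (L : Matrix (Fin d) (Fin n) ℝ → Matrix (Fin n) (Fin m) ℝ → ℝ)
    (hLdef : ∀ (W : Matrix (Fin d) (Fin n) ℝ) (H : Matrix (Fin n) (Fin m) ℝ),
      L W H = ∑ i, ∑ j, (X i j - (W * H) i j) ^ 2
        + lw * ∑ i, ∑ j, Real.log (τw + W i j)
        + lh * ∑ i, ∑ j, Real.log (τh + H i j))
    (Wt : Matrix (Fin d) (Fin n) ℝ) (Ht : Matrix (Fin n) (Fin m) ℝ)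
    (hWt : ∀ i j, 0 < Wt i j) (hHt : ∀ i j, 0 < Ht i j)
    (Wp : Matrix (Fin d) (Fin n) ℝ)
    (hdenW : ∀ i j, 0 < (Wt * Ht * Htᵀ) i j + lw / (2 * (τw + Wt i j)))
    (hWp : ∀ i j, Wp i j = Wt i j * (X * Htᵀ) i j /
      ((Wt * Ht * Htᵀ) i j + lw / (2 * (τw + Wt i j))))
    (Hp : Matrix (Fin n) (Fin m) ℝ)
    (hdenH : ∀ i j, 0 < (Wpᵀ * Wp * Ht) i j + lh / (2 * (τh + Ht i j)))
    (hHp : ∀ i j, Hp i j = Ht i j * (Wpᵀ * X) i j /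
      ((Wpᵀ * Wp * Ht) i j + lh / (2 * (τh + Ht i j)))) :
    L Wp Hp ≤ L Wp Ht ∧ L Wp Ht ≤ L Wt Ht := by
  have hWp0 : ∀ i j, 0 ≤ Wp i j := fun i j => by
    rw [hWp i j, mul_apply]
    exact div_nonneg (mul_nonneg (hWt i j).le
      (Finset.sum_nonneg fun k _ => mul_nonneg (hX i k) (hHt j k).le)) (hdenW i j).le
  constructor
  · have key := Finset.sum_le_sum fun j (_ : j ∈ Finset.univ) =>
      reweighted_multiplicative_update_le (fun i k => Wp i k) hWp0 (fun i => X i j)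
        (fun i => hX i j) hlh hτh (fun k => Ht k j) (fun k => Hp k j) (fun k => hHt k j)
        (fun k => by
          rw [hHp k j, Matrix.mul_assoc]
          simp only [mul_apply, transpose_apply])
    simp only [Finset.sum_add_distrib, ← Finset.mul_sum] at key
    rw [hLdef, hLdef]
    simp only [mul_apply]
    rw [Finset.sum_comm, Finset.sum_comm (f := fun i j => Real.log (τh + Hp i j)),
      Finset.sum_comm (f := fun i j => (X i j - ∑ k, Wp i k * Ht k j) ^ 2),
      Finset.sum_comm (f := fun i j => Real.log (τh + Ht i j))]
    linarith
  · have key := Finset.sum_le_sum fun i (_ : i ∈ Finset.univ) =>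
      reweighted_multiplicative_update_le (fun j k => Ht k j) (fun j k => (hHt k j).le)
        (fun j => X i j) (fun j => hX i j) hlw hτw (fun k => Wt i k) (fun k => Wp i k)
        (fun k => hWt i k)
        (fun k => by
          rw [hWp i k]
          simp only [mul_apply, transpose_apply, mul_comm])
    simp only [Finset.sum_add_distrib, ← Finset.mul_sum] at key
    rw [hLdef, hLdef]
    simp only [mul_apply]
    simp only [mul_comm (Ht _ _)] at key
    linarith
end
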